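/- Let C ⊆ ℝ^d be convex, A ∈ ℝ^{n×d}, y ∈ ℝⁿ, and S ∈ ℝ^{m×n}. If x_LS ∈ C minimizes x ↦ (1/(2n))‖A x − y‖₂² over C and x̂ ∈ C minimizes x ↦ (1/(2m))‖S A x‖₂² − ⟨Aᵀ y, x⟩ over C, then the error vector Δ = x̂ − x_LS satisfies the basic inequality (1/m)‖S A Δ‖₂² ≤ |⟨A x_LS, (Iₙ − (Sᵀ S)/m) A Δ⟩|. -/

import Mathlib

open MeasureTheory Matrix Finset

/-- Squared Euclidean norm of a vector. -/
noncomputable def sqNorm {k : ℕ} (v : Fin k → ℝ) : ℝ := ∑ i, (v i) ^ 2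

/-- Euclidean (ℓ₂) norm of a vector. -/
noncomputable def l2norm {k : ℕ} (v : Fin k → ℝ) : ℝ := Real.sqrt (sqNorm v)

/-- Prediction semi-norm ‖v‖_A = (1/√n)‖A v‖₂. -/
noncomputable def predNorm {n d : ℕ} (A : Matrix (Fin n) (Fin d) ℝ) (v : Fin d → ℝ) : ℝ :=
  l2norm (A.mulVec v) / Real.sqrt n

/-- Transformed tangent cone K_LS = {t · A(x − x_LS) : t ≥ 0, x ∈ C}. -/
def Kcone {n d : ℕ} (A : Matrix (Fin n) (Fin d) ℝ) (C : Set (Fin d → ℝ))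
    (xLS : Fin d → ℝ) : Set (Fin n → ℝ) :=
  {v | ∃ t : ℝ, 0 ≤ t ∧ ∃ x ∈ C, v = t • A.mulVec (x - xLS)}

/-- Z₁(S) = inf over unit-norm vectors of the cone of (1/m)‖S v‖₂². -/
noncomputable def Z1 {n m : ℕ} (S : Matrix (Fin m) (Fin n) ℝ) (K : Set (Fin n → ℝ)) : ℝ :=
  sInf ((fun v => (1 / (m : ℝ)) * sqNorm (S.mulVec v)) '' {v ∈ K | l2norm v = 1})

/-- Z₂(S) = sup over unit-norm vectors of the cone of |⟨u, (SᵀS/m − I) v⟩|. -/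
noncomputable def Z2 {n m : ℕ} (S : Matrix (Fin m) (Fin n) ℝ) (K : Set (Fin n → ℝ))
    (u : Fin n → ℝ) : ℝ :=
  sSup ((fun v => |u ⬝ᵥ (((1 / (m : ℝ)) • (Sᵀ * S) - 1).mulVec v)|) '' {v ∈ K | l2norm v = 1})

lemma aux_first_order (a b : ℝ) (h : ∀ t : ℝ, 0 < t → t ≤ 1 → 0 ≤ t * a + t ^ 2 * b) : 0 ≤ a := by
  by_contra hlt
  push Not at hlt
  have hd : 0 < |b| - a := by have := abs_nonneg b; linarith
  have hpos : 0 < -a / (2 * (|b| - a)) := by apply div_pos <;> linarith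
  have hle : -a / (2 * (|b| - a)) ≤ 1 := by
    rw [div_le_one (by linarith)]
    have := abs_nonneg b; linarith
  have h1 := h _ hpos hle
  set t := -a / (2 * (|b| - a)) with ht
  have h2 : 0 ≤ t * (a + t * b) := by nlinarith
  have h3 : 0 ≤ a + t * b := nonneg_of_mul_nonneg_right h2 hpos
  have h4 : t * (2 * (|b| - a)) = -a := by rw [ht]; field_simp
  nlinarith [le_abs_self b, mul_le_mul_of_nonneg_left (le_abs_self b) hpos.le, abs_nonneg b]

lemma aux_sqNorm {k : ℕ} (v : Fin k → ℝ) : sqNorm v = v ⬝ᵥ v := by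
  simp [sqNorm, dotProduct, pow_two]

lemma aux_sqNorm_add {k : ℕ} (v w : Fin k → ℝ) (t : ℝ) :
    sqNorm (v + t • w) = sqNorm v + 2 * t * (v ⬝ᵥ w) + t ^ 2 * sqNorm w := by
  simp only [aux_sqNorm, add_dotProduct, dotProduct_add, smul_dotProduct, dotProduct_smul,
    smul_eq_mul, dotProduct_comm w v]
  ring

/-- basic inequality for the Hessian sketch. -/
theorem hessian_sketch_basic_inequality
    {n d m : ℕ} (hn : 0 < n) (hm : 0 < m)
    (C : Set (Fin d → ℝ)) (hC : Convex ℝ C)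
    (A : Matrix (Fin n) (Fin d) ℝ) (y : Fin n → ℝ)
    (S : Matrix (Fin m) (Fin n) ℝ)
    (xLS : Fin d → ℝ) (hLSmem : xLS ∈ C)
    (hLSmin : ∀ x ∈ C,
      (1 / (2 * (n : ℝ))) * sqNorm (A.mulVec xLS - y)
        ≤ (1 / (2 * (n : ℝ))) * sqNorm (A.mulVec x - y))
    (xhat : Fin d → ℝ) (hhatmem : xhat ∈ C)
    (hhatmin : ∀ x ∈ C,
      (1 / (2 * (m : ℝ))) * sqNorm (S.mulVec (A.mulVec xhat)) - (Aᵀ.mulVec y) ⬝ᵥ xhat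
        ≤ (1 / (2 * (m : ℝ))) * sqNorm (S.mulVec (A.mulVec x)) - (Aᵀ.mulVec y) ⬝ᵥ x) :
    (1 / (m : ℝ)) * sqNorm (S.mulVec (A.mulVec (xhat - xLS))) ≤
      |(A.mulVec xLS) ⬝ᵥ ((1 - (1 / (m : ℝ)) • (Sᵀ * S)).mulVec (A.mulVec (xhat - xLS)))| := by
  have hm' : (0 : ℝ) < m := by exact_mod_cast hm
  have hn' : (0 : ℝ) < n := by exact_mod_cast hn
  obtain ⟨D, rfl⟩ : ∃ D, xhat = xLS + D := ⟨xhat - xLS, by abel⟩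
  rw [add_sub_cancel_left]
  have key1 : 0 ≤ 2 * ((A.mulVec xLS - y) ⬝ᵥ A.mulVec D) := by
    apply aux_first_order _ (sqNorm (A.mulVec D))
    intro t ht0 ht1
    have hx : xLS + t • D ∈ C := by
      have := hC.add_smul_mem hLSmem hhatmem ⟨ht0.le, ht1⟩
      exact this
    have h := le_of_mul_le_mul_left (hLSmin _ hx) (by positivity)
    have e : A.mulVec (xLS + t • D) - y = (A.mulVec xLS - y) + t • A.mulVec D := by
      rw [mulVec_add, mulVec_smul]; abel
    rw [e, aux_sqNorm_add] at h
    linarith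
  have key2 : 0 ≤ -(1 / (m : ℝ)) * (S.mulVec (A.mulVec (xLS + D)) ⬝ᵥ S.mulVec (A.mulVec D))
      + (Aᵀ.mulVec y) ⬝ᵥ D := by
    apply aux_first_order _ ((1 / (2 * (m : ℝ))) * sqNorm (S.mulVec (A.mulVec D)))
    intro t ht0 ht1
    have hx : (xLS + D) + (-t) • D ∈ C := by
      have := hC.add_smul_mem hLSmem hhatmem (t := 1 - t) ⟨by linarith, by linarith⟩
      convert this using 1
      module
    have h := hhatmin _ hx
    rw [mulVec_add A (xLS + D), mulVec_smul, mulVec_add S, mulVec_smul, aux_sqNorm_add,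
      dotProduct_add _ (xLS + D), dotProduct_smul, smul_eq_mul] at h
    have e : 1 / (m : ℝ) = 2 * (1 / (2 * (m : ℝ))) := by field_simp
    rw [e]
    nlinarith
  have e1 : (Aᵀ.mulVec y) ⬝ᵥ D = y ⬝ᵥ A.mulVec D := by
    rw [mulVec_transpose, dotProduct_mulVec]
  have e2 : (A.mulVec xLS) ⬝ᵥ ((1 - (1 / (m : ℝ)) • (Sᵀ * S)).mulVec (A.mulVec D))
      = A.mulVec xLS ⬝ᵥ A.mulVec D
        - (1 / (m : ℝ)) * (S.mulVec (A.mulVec xLS) ⬝ᵥ S.mulVec (A.mulVec D)) := by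
    rw [sub_mulVec, one_mulVec, dotProduct_sub, smul_mulVec, dotProduct_smul, smul_eq_mul,
      ← mulVec_mulVec, dotProduct_mulVec _ Sᵀ, vecMul_transpose]
  refine le_trans ?_ (le_abs_self _)
  rw [e2]
  rw [e1, mulVec_add, mulVec_add, add_dotProduct, ← aux_sqNorm] at key2
  rw [sub_dotProduct] at key1
  linarith
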